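/- Let 0 < p < 1 and C > 0 be fixed and m = ⌊pN⌋. Let k = k(n) be a sequence of complete colouring profiles with k_u = 0 for all u < 0.1·α and all u > 10·α. If n/k > α_0 − 1 − 2/ln b + C, then E_m[X̄_k] < exp(−(C·ln b / 2)·n + o(n)) and E_p[X̄_k] < exp(−(C·ln b / 2)·n + o(n)). -/

import Mathlib

open Filter
open scoped BigOperators Classical

noncomputable section

/-- The number of edges of a simple graph on `Fin n`. -/
def edgeCount {n : ℕ} (G : SimpleGraph (Fin n)) : ℕ := Nat.card G.edgeSet

/-- Probability of a graph property under the uniform random graph `G(n,m)`. -/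
def Pm (n m : ℕ) (E : SimpleGraph (Fin n) → Prop) : ℝ :=
  (Nat.card {G : SimpleGraph (Fin n) // edgeCount G = m ∧ E G} : ℝ) /
    (Nat.card {G : SimpleGraph (Fin n) // edgeCount G = m} : ℝ)

/-- Expectation of a real functional under the uniform random graph `G(n,m)`. -/
def Em (n m : ℕ) (X : SimpleGraph (Fin n) → ℝ) : ℝ :=
  (∑ᶠ G : {G : SimpleGraph (Fin n) // edgeCount G = m}, X G.1) /
    (Nat.card {G : SimpleGraph (Fin n) // edgeCount G = m} : ℝ)

/-- Probability of a graph property under the binomial random graph `G(n,p)`. -/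
def Pp (n : ℕ) (p : ℝ) (E : SimpleGraph (Fin n) → Prop) : ℝ :=
  ∑ᶠ G : SimpleGraph (Fin n),
    (if E G then (1 : ℝ) else 0) * p ^ edgeCount G * (1 - p) ^ (n.choose 2 - edgeCount G)

/-- Expectation of a real functional under the binomial random graph `G(n,p)`. -/
def Ep (n : ℕ) (p : ℝ) (X : SimpleGraph (Fin n) → ℝ) : ℝ :=
  ∑ᶠ G : SimpleGraph (Fin n),
    X G * p ^ edgeCount G * (1 - p) ^ (n.choose 2 - edgeCount G)

/-- `α₀(n) = 2 log_b n − 2 log_b log_b n + 2 log_b (e/2) + 1`. -/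
def alpha0 (b : ℝ) (n : ℕ) : ℝ :=
  2 * Real.logb b n - 2 * Real.logb b (Real.logb b n) + 2 * Real.logb b (Real.exp 1 / 2) + 1

/-- `α(n) = ⌊α₀(n)⌋`. -/
def alphaNat (b : ℝ) (n : ℕ) : ℕ := ⌊alpha0 b n⌋₊

/-- `μ_t = C(n,t) q^{C(t,2)}`, the expected number of independent `t`-sets. -/
def muExp (q : ℝ) (n t : ℕ) : ℝ := (n.choose t : ℝ) * q ^ t.choose 2

/-- A finset of vertices is independent in `G`. -/
def IndepFinset {n : ℕ} (G : SimpleGraph (Fin n)) (s : Finset (Fin n)) : Prop :=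
  ∀ v ∈ s, ∀ w ∈ s, ¬ G.Adj v w

/-- `G` has a proper colouring with `k` colours, all colour classes of size at most `t`. -/
def HasBoundedColouring {n : ℕ} (G : SimpleGraph (Fin n)) (t k : ℕ) : Prop :=
  ∃ C : Fin n → Fin k, (∀ v w, G.Adj v w → C v ≠ C w) ∧
    ∀ c : Fin k, (Finset.univ.filter fun v => C v = c).card ≤ t

/-- The `t`-bounded chromatic number `χ_t(G)`. -/
def chiBounded {n : ℕ} (G : SimpleGraph (Fin n)) (t : ℕ) : ℕ :=
  sInf {k | HasBoundedColouring G t k}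

/-- `G` has an equitable proper colouring with `k` colours. -/
def HasEquitableColouring {n : ℕ} (G : SimpleGraph (Fin n)) (k : ℕ) : Prop :=
  ∃ C : Fin n → Fin k, (∀ v w, G.Adj v w → C v ≠ C w) ∧
    ∀ c c' : Fin k,
      (Finset.univ.filter fun v => C v = c).card ≤
        (Finset.univ.filter fun v => C v = c').card + 1

/-- The equitable chromatic number `χ₌(G)`. -/
def chiEquitable {n : ℕ} (G : SimpleGraph (Fin n)) : ℕ :=
  sInf {k | HasEquitableColouring G k}

/-- The number of unordered `t`-bounded proper `k`-colourings of `G`, i.e. partitions of the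
vertex set into exactly `k` nonempty independent sets, each of size at most `t`. -/
def numUnorderedColourings (n t k : ℕ) (G : SimpleGraph (Fin n)) : ℕ :=
  Set.ncard {Q : Finset (Finset (Fin n)) | Q.card = k ∧
    (∀ s ∈ Q, s.Nonempty ∧ s.card ≤ t ∧ IndepFinset G s) ∧
    (∀ v : Fin n, ∃ s ∈ Q, v ∈ s) ∧
    ∀ s ∈ Q, ∀ s' ∈ Q, s ≠ s' → Disjoint s s'}

/-- `E_{n,k,t}`: the expected number of unordered `t`-bounded `k`-colourings of `G_{n,1/2}`. -/
def Enkt (n k t : ℕ) : ℝ := Ep n (1/2) fun G => (numUnorderedColourings n t k G : ℝ)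

/-- The `t`-bounded first moment threshold `k_t(n)`. -/
def fmThreshold (n t : ℕ) : ℕ := sInf {k | 1 ≤ Enkt n k t}

/-- `P` is a (possibly partial) `k`-colouring profile on `n` vertices. -/
def IsProfile (n k : ℕ) (P : ℕ → ℕ) : Prop :=
  (∀ u, u ∉ Finset.Icc 1 n → P u = 0) ∧
    (∑ u ∈ Finset.Icc 1 n, P u = k) ∧ (∑ u ∈ Finset.Icc 1 n, u * P u ≤ n)

/-- A colouring profile is complete if its classes use all `n` vertices. -/
def IsCompleteProfile (n : ℕ) (P : ℕ → ℕ) : Prop :=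
  ∑ u ∈ Finset.Icc 1 n, u * P u = n

/-- A colouring profile is `t`-bounded if it has no classes of size larger than `t`. -/
def IsBoundedProfile (t : ℕ) (P : ℕ → ℕ) : Prop := ∀ u, t < u → P u = 0

/-- The number of parts of a profile on `n` vertices. -/
def profileParts (n : ℕ) (P : ℕ → ℕ) : ℕ := ∑ u ∈ Finset.Icc 1 n, P u

/-- `X_k`: the number of ordered (partial) proper colourings of `G` with profile `P`:
ordered tuples of pairwise disjoint independent sets, decreasing in size, with exactly
`P u` parts of size `u` for every `u`. -/
def Xprofile {n : ℕ} (G : SimpleGraph (Fin n)) (P : ℕ → ℕ) : ℕ :=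
  Set.ncard {V : Fin (profileParts n P) → Finset (Fin n) |
    (∀ i j, i ≠ j → Disjoint (V i) (V j)) ∧
    (∀ i j, i ≤ j → (V j).card ≤ (V i).card) ∧
    (∀ u : ℕ, (Finset.univ.filter fun i => (V i).card = u).card = P u) ∧
    ∀ i, IndepFinset G (V i)}

/-- `X̄_k = X_k / ∏_u k_u!`: the number of unordered colourings with profile `P`. -/
def Xbar {n : ℕ} (G : SimpleGraph (Fin n)) (P : ℕ → ℕ) : ℝ :=
  (Xprofile G P : ℝ) / ∏ u ∈ Finset.Icc 1 n, ((P u).factorial : ℝ)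

/-- `κ = Σ_u κ_u` where `κ_u = u k_u / n`. -/
def kappaTot (n : ℕ) (P : ℕ → ℕ) : ℝ := ∑ u ∈ Finset.Icc 1 n, (u : ℝ) * P u / n

/-- `m = ⌊p N⌋` with `N = C(n,2)`. -/
def mFloor (p : ℝ) (n : ℕ) : ℕ := ⌊p * (n.choose 2 : ℝ)⌋₊

/-- Definition 2.2: a sequence `P` of complete `a`-bounded colouring profiles is tame. -/
def IsTame (p : ℝ) (a : ℕ → ℕ) (P : ℕ → ℕ → ℕ) : Prop :=
  (∃ C : ℝ, ∀ᶠ n in atTop, alpha0 (1/(1-p)) n - C ≤ (a n : ℝ)) ∧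
  (∀ᶠ n in atTop, a n ≤ alphaNat (1/(1-p)) n) ∧
  (∀ n, IsProfile n (profileParts n (P n)) (P n) ∧ IsCompleteProfile n (P n) ∧
      IsBoundedProfile (a n) (P n)) ∧
  ∃ c : ℝ, c ∈ Set.Ioo (0:ℝ) 1 ∧ ∃ γ : ℕ → ℝ, Monotone γ ∧ Tendsto γ atTop atTop ∧
    (∀ᶠ n in atTop, ∀ u, 1 ≤ u → u ≤ a n →
      (u : ℝ) * P n u / n <
        (1/(1-p)) ^ (-(((alphaNat (1/(1-p)) n - u : ℕ) : ℝ) *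
          γ (alphaNat (1/(1-p)) n - u)))) ∧
    ∀ ε : ℝ, 0 < ε → ∀ᶠ n : ℕ in atTop,
      Real.exp (-ε * (n : ℝ) ^ ((1:ℝ) - c)) ≤ Em n (mFloor p n) fun G => Xbar G (P n)

/-- The function `φ(κ)` from Lemma 3.3. -/
def phiProfile (p : ℝ) (n : ℕ) (P : ℕ → ℕ) : ℝ :=
  -(1 - kappaTot n P) * Real.log (1 - kappaTot n P) +
    Real.log (1/(1-p)) / 2 * ∑ u ∈ Finset.Icc 1 n,
      ((u : ℝ) * P u / n) * (alpha0 (1/(1-p)) n - 1 - 2 / Real.log (1/(1-p)) - (u : ℝ))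

/-- The function `φ̃_δ(x)` from Lemma 3.5. -/
def phiTilde (p δ x : ℝ) : ℝ :=
  -(1 - x) * Real.log (1 - x) - (1 - Real.log (1/(1-p)) / 2 * δ) * x

/-- `d_u = 2^{C(u,2)} u!`. -/
def dcoef (u : ℕ) : ℝ := 2 ^ u.choose 2 * (u.factorial : ℝ)

/-- `L_0(n,k,t)`: the supremum of `L_k` over real-valued `t`-bounded complete profiles. -/
def L0 (n k t : ℕ) : ℝ :=
  sSup {y : ℝ | ∃ f : ℕ → ℝ, (∀ u ∈ Finset.Icc 1 t, 0 ≤ f u) ∧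
    (∑ u ∈ Finset.Icc 1 t, f u = (k : ℝ)) ∧ (∑ u ∈ Finset.Icc 1 t, (u : ℝ) * f u = (n : ℝ)) ∧
    y = (n : ℝ) * Real.log n - (n : ℝ) + (k : ℝ) -
      ∑ u ∈ Finset.Icc 1 t, f u * Real.log (f u * dcoef u)}

/-- Membership in `P_{n,k,t}`: a `t`-bounded complete `k`-colouring profile on `n` vertices. -/
def IsKTProfile (n k t : ℕ) (P : ℕ → ℕ) : Prop :=
  (∀ u, u ∉ Finset.Icc 1 t → P u = 0) ∧
    (∑ u ∈ Finset.Icc 1 t, P u = k) ∧ (∑ u ∈ Finset.Icc 1 t, u * P u = n)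

/-- `E_{n,k,t}` written as the sum over profiles of `E_{1/2}[X̄_k]`. -/
def EnktSum (n k t : ℕ) : ℝ :=
  ∑ᶠ P : ℕ → ℕ, if IsKTProfile n k t P then Ep n (1/2) fun G => Xbar G P else 0


/-- Edge set of a graph as a finset. -/
def es {n : ℕ} (G : SimpleGraph (Fin n)) : Finset (Sym2 (Fin n)) := G.edgeSet.toFinset

/-- All possible edges. -/
def allE (n : ℕ) : Finset (Sym2 (Fin n)) := Finset.univ.filter fun e => ¬ e.IsDiag

lemma mem_es {n : ℕ} (G : SimpleGraph (Fin n)) (e) : e ∈ es G ↔ e ∈ G.edgeSet := by simp [es]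

lemma edgeCount_eq {n : ℕ} (G : SimpleGraph (Fin n)) : edgeCount G = (es G).card := by
  rw [edgeCount, es, Nat.card_eq_fintype_card, Set.toFinset_card]

lemma card_allE (n : ℕ) : (allE n).card = n.choose 2 := by
  have h := Sym2.card_subtype_not_diag (α := Fin n)
  rw [Fintype.card_fin] at h
  rw [← h, allE, Fintype.card_subtype]

lemma sum_graph {n : ℕ} (g : Finset (Sym2 (Fin n)) → ℝ) :
    ∑ G : SimpleGraph (Fin n), g (es G) = ∑ A ∈ (allE n).powerset, g A := by
  refine Finset.sum_bij' (fun G _ => es G) (fun A _ => SimpleGraph.fromEdgeSet (A : Set (Sym2 (Fin n))))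
    ?_ ?_ ?_ ?_ ?_
  · intro G _
    rw [Finset.mem_powerset]
    intro e he
    rw [mem_es] at he
    simp only [allE, Finset.mem_filter, Finset.mem_univ, true_and]
    exact SimpleGraph.not_isDiag_of_mem_edgeSet G he
  · intro A _; simp
  · intro G _
    have : ((es G : Finset _) : Set (Sym2 (Fin n))) = G.edgeSet := by simp [es]
    simp only [this]
    exact SimpleGraph.fromEdgeSet_edgeSet G
  · intro A hA
    rw [Finset.mem_powerset] at hA
    ext e
    rw [mem_es, SimpleGraph.edgeSet_fromEdgeSet]
    constructor
    · intro h; exact_mod_cast h.1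
    · intro h
      refine ⟨by exact_mod_cast h, ?_⟩
      have := hA h
      simpa [allE] using this
  · intros; rfl

lemma filter_disj {n : ℕ} (F : Finset (Sym2 (Fin n))) :
    (allE n).powerset.filter (fun A => Disjoint A F) = (allE n \ F).powerset := by
  ext A
  simp only [Finset.mem_filter, Finset.mem_powerset, Finset.subset_sdiff]

lemma prob_p {n : ℕ} (p : ℝ) (F : Finset (Sym2 (Fin n))) (hF : F ⊆ allE n) :
    ∑ G : SimpleGraph (Fin n), (p ^ edgeCount G * (1 - p) ^ (n.choose 2 - edgeCount G)) *
      (if Disjoint (es G) F then (1:ℝ) else 0) = (1 - p) ^ F.card := by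
  simp only [edgeCount_eq]
  rw [sum_graph (fun A => (p ^ A.card * (1 - p) ^ (n.choose 2 - A.card)) *
      (if Disjoint A F then (1:ℝ) else 0))]
  simp only [mul_ite, mul_one, mul_zero]
  rw [← Finset.sum_filter, filter_disj]
  have hc : (allE n \ F).card = n.choose 2 - F.card := by
    rw [Finset.card_sdiff_of_subset hF, card_allE]
  have hle : F.card ≤ n.choose 2 := by rw [← card_allE]; exact Finset.card_le_card hF
  have : ∀ A ∈ (allE n \ F).powerset, p ^ A.card * (1 - p) ^ (n.choose 2 - A.card) =
      (p ^ A.card * (1 - p) ^ ((allE n \ F).card - A.card)) * (1-p) ^ F.card := by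
    intro A hA
    have hA := Finset.card_le_card (Finset.mem_powerset.1 hA)
    rw [mul_assoc, ← pow_add]
    congr 2
    omega
  rw [Finset.sum_congr rfl this, ← Finset.sum_mul, Finset.sum_pow_mul_eq_add_pow]
  simp

lemma count_m {n : ℕ} (m : ℕ) (F : Finset (Sym2 (Fin n))) (hF : F ⊆ allE n) :
    ∑ G : SimpleGraph (Fin n), (if edgeCount G = m then (1:ℝ) else 0) *
      (if Disjoint (es G) F then (1:ℝ) else 0) = ((n.choose 2 - F.card).choose m : ℕ) := by
  simp only [edgeCount_eq]
  rw [sum_graph (fun A => (if A.card = m then (1:ℝ) else 0) *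
      (if Disjoint A F then (1:ℝ) else 0))]
  simp only [mul_ite, mul_one, mul_zero]
  rw [← Finset.sum_filter, filter_disj, ← Finset.sum_filter]
  have hc : (allE n \ F).card = n.choose 2 - F.card := by
    rw [Finset.card_sdiff_of_subset hF, card_allE]
  rw [← hc, ← Finset.card_powersetCard, Finset.powersetCard_eq_filter]
  simp

lemma Ep_eq (n : ℕ) (p : ℝ) (X : SimpleGraph (Fin n) → ℝ) :
    Ep n p X = ∑ G, (p ^ edgeCount G * (1 - p) ^ (n.choose 2 - edgeCount G)) * X G := by
  rw [Ep, finsum_eq_sum_of_fintype]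
  exact Finset.sum_congr rfl fun G _ => by ring

lemma Em_eq (n m : ℕ) (X : SimpleGraph (Fin n) → ℝ) :
    Em n m X = ∑ G, ((if edgeCount G = m then (1:ℝ) else 0) / ((n.choose 2).choose m : ℕ)) * X G := by
  have hcard : (Nat.card {G : SimpleGraph (Fin n) // edgeCount G = m} : ℝ) =
      ((n.choose 2).choose m : ℕ) := by
    have := count_m (n := n) m ∅ (by simp)
    simp only [Finset.disjoint_empty_right, if_true, mul_one, Finset.card_empty, Nat.sub_zero] at this
    rw [← this, Nat.card_eq_fintype_card, Fintype.card_subtype]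
    simp
  rw [Em, hcard, finsum_eq_sum_of_fintype, Finset.sum_div]
  rw [← Finset.sum_subtype (Finset.univ.filter fun G : SimpleGraph (Fin n) => edgeCount G = m)
    (fun G => by simp) (fun G => X G / ((n.choose 2).choose m : ℕ)), Finset.sum_filter]
  refine Finset.sum_congr rfl fun G _ => ?_
  split_ifs <;> ring

lemma choose_ratio (N m f : ℕ) (hN : 0 < N) (hm : m ≤ N) (hf : f ≤ N) :
    ((N - f).choose m : ℝ) ≤ (N.choose m : ℝ) * (((N:ℝ) - m) / N) ^ f := by
  have hN' : (0:ℝ) < N := by exact_mod_cast hN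
  have hm' : (m:ℝ) ≤ N := by exact_mod_cast hm
  have h0 : 0 ≤ ((N:ℝ) - m) / N := div_nonneg (by linarith) hN'.le
  induction f with
  | zero => simp
  | succ f ih =>
    have ih := ih (by omega)
    obtain ⟨M, hM⟩ : ∃ M, N - f = M + 1 := ⟨N - f - 1, by omega⟩
    have hM2 : N - (f+1) = M := by omega
    rw [hM2, pow_succ, ← mul_assoc]
    rw [hM] at ih
    refine le_trans ?_ (mul_le_mul_of_nonneg_right ih h0)
    by_cases hmM : m ≤ M
    · have h := Nat.choose_mul_succ_eq M m
      have h' : (M.choose m : ℝ) * (M+1) = ((M+1).choose m : ℝ) * ((M:ℝ)+1-m) := by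
        have : ((M + 1 - m : ℕ) : ℝ) = (M:ℝ)+1-m := by
          rw [Nat.cast_sub (by omega)]; push_cast; ring
        rw [← this]; exact_mod_cast h
      have hMN : (M:ℝ) + 1 ≤ N := by
        have : M + 1 ≤ N := by omega
        exact_mod_cast this
      have e : (M.choose m : ℝ) = ((M+1).choose m : ℝ) * (((M:ℝ)+1-m) / (M+1)) := by
        rw [← mul_div_assoc, ← h']; field_simp
      rw [e]
      apply mul_le_mul_of_nonneg_left _ (by positivity)
      rw [div_le_div_iff₀ (by positivity) hN']
      nlinarith [(Nat.cast_nonneg m : (0:ℝ) ≤ m)]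
    · rw [Nat.choose_eq_zero_of_lt (by omega)]
      push_cast
      positivity

/-- The pairs inside the parts of `V`. -/
def FV {n k : ℕ} (V : Fin k → Finset (Fin n)) : Finset (Sym2 (Fin n)) :=
  Finset.univ.biUnion fun i => Finset.image (Function.uncurry Sym2.mk) (V i).offDiag

lemma mem_FV {n k : ℕ} (V : Fin k → Finset (Fin n)) (v w : Fin n) :
    s(v, w) ∈ FV V ↔ ∃ i, v ∈ V i ∧ w ∈ V i ∧ v ≠ w := by
  simp only [FV, Finset.mem_biUnion, Finset.mem_univ, true_and, Finset.mem_image,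
    Finset.mem_offDiag, Prod.exists, Function.uncurry_apply_pair, Sym2.eq_iff]
  constructor
  · rintro ⟨i, a, b, ⟨ha, hb, hab⟩, ⟨rfl, rfl⟩ | ⟨rfl, rfl⟩⟩
    · exact ⟨i, ha, hb, hab⟩
    · exact ⟨i, hb, ha, hab.symm⟩
  · rintro ⟨i, ha, hb, hab⟩
    exact ⟨i, v, w, ⟨ha, hb, hab⟩, Or.inl ⟨rfl, rfl⟩⟩

lemma FV_sub {n k : ℕ} (V : Fin k → Finset (Fin n)) : FV V ⊆ allE n := by
  intro e
  induction e with
  | _ v w =>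
    rw [mem_FV]
    rintro ⟨i, _, _, h⟩
    simpa [allE] using h

lemma FV_card {n k : ℕ} (V : Fin k → Finset (Fin n)) (hV : ∀ i j, i ≠ j → Disjoint (V i) (V j)) :
    (FV V).card = ∑ i, (V i).card.choose 2 := by
  rw [FV, Finset.card_biUnion]
  · exact Finset.sum_congr rfl fun i _ => Sym2.card_image_offDiag _
  · intro i _ j _ hij
    have hd := hV i j hij
    simp only [Function.onFun]
    rw [Finset.disjoint_left]
    intro e
    induction e with
    | _ v w =>
      simp only [Finset.mem_image, Finset.mem_offDiag, Prod.exists, Function.uncurry_apply_pair,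
        Sym2.eq_iff, not_exists]
      rintro ⟨a, b, ⟨ha, hb, hab⟩, h⟩ c d ⟨⟨hc, hd', hcd⟩, h'⟩
      rw [Finset.disjoint_left] at hd
      have hv : v ∈ V i := by rcases h with ⟨rfl, rfl⟩ | ⟨rfl, rfl⟩ <;> assumption
      have hv' : v ∈ V j := by rcases h' with ⟨rfl, rfl⟩ | ⟨rfl, rfl⟩ <;> assumption
      exact hd hv hv'

lemma FV_card_ge {n k : ℕ} (hk : 0 < k) (V : Fin k → Finset (Fin n))
    (hV : ∀ i j, i ≠ j → Disjoint (V i) (V j)) (hn : ∑ i, (V i).card = n) :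
    ((n:ℝ)^2 / k - n) / 2 ≤ (FV V).card := by
  rw [FV_card V hV]
  have hk' : (0:ℝ) < k := by exact_mod_cast hk
  push_cast
  simp only [Nat.cast_choose_two]
  have hn' : ∑ i, ((V i).card : ℝ) = n := by exact_mod_cast hn
  have h := sq_sum_le_card_mul_sum_sq (s := Finset.univ) (f := fun i => ((V i).card : ℝ))
  rw [hn'] at h
  simp only [Finset.card_univ, Fintype.card_fin] at h
  have h2 : (n:ℝ)^2 / k ≤ ∑ i, ((V i).card : ℝ)^2 := by
    rw [div_le_iff₀ hk']; linarith
  have h3 : ∑ i, ((V i).card : ℝ) * (((V i).card : ℝ) - 1) / 2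
      = (∑ i, ((V i).card : ℝ)^2 - ∑ i, ((V i).card : ℝ)) / 2 := by
    rw [← Finset.sum_sub_distrib, Finset.sum_div]
    exact Finset.sum_congr rfl fun i _ => by ring
  rw [h3, hn']
  linarith

/-- The set of disjoint covering tuples. -/
def tuples (n k : ℕ) : Finset (Fin k → Finset (Fin n)) :=
  Finset.univ.filter fun V => (∀ i j, i ≠ j → Disjoint (V i) (V j)) ∧ ∑ i, (V i).card = n

lemma card_tuples (n k : ℕ) : (tuples n k).card ≤ k ^ n := by
  have hsub : tuples n k ⊆ (Finset.univ : Finset (Fin n → Fin k)).image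
      (fun c i => Finset.univ.filter fun v => c v = i) := by
    intro V hV
    simp only [tuples, Finset.mem_filter, Finset.mem_univ, true_and] at hV
    obtain ⟨hd, hs⟩ := hV
    have hu : Finset.univ.biUnion V = Finset.univ := by
      apply Finset.eq_univ_of_card
      rw [Finset.card_biUnion (fun i _ j _ h => hd i j h), hs, Fintype.card_fin]
    have hc : ∀ v, ∃ i, v ∈ V i := by
      intro v
      have : v ∈ Finset.univ.biUnion V := by rw [hu]; simp
      simpa using this
    choose c hc using hc
    rw [Finset.mem_image]
    refine ⟨c, by simp, ?_⟩
    funext i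
    ext v
    simp only [Finset.mem_filter, Finset.mem_univ, true_and]
    constructor
    · rintro rfl; exact hc v
    · intro h
      by_contra hne
      exact Finset.disjoint_left.1 (hd _ _ hne) (hc v) h
  refine (Finset.card_le_card hsub).trans (Finset.card_image_le.trans ?_)
  simp

lemma Xprofile_le {n : ℕ} (G : SimpleGraph (Fin n)) (P : ℕ → ℕ)
    (hprof : IsProfile n (profileParts n P) P) (hc : IsCompleteProfile n P) :
    (Xprofile G P : ℝ) ≤ ∑ V ∈ tuples n (profileParts n P),
      (if Disjoint (es G) (FV V) then (1:ℝ) else 0) := by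
  rw [← Finset.sum_filter, Finset.sum_const, nsmul_eq_mul, mul_one, Nat.cast_le, Xprofile,
    ← Set.ncard_coe_finset]
  apply Set.ncard_le_ncard _ (Finset.finite_toSet _)
  rintro V ⟨hd, -, hcount, hind⟩
  simp only [Finset.coe_filter, Set.mem_ofPred_eq, tuples, Finset.mem_filter, Finset.mem_univ,
    true_and]
  refine ⟨⟨hd, ?_⟩, ?_⟩
  · have hmaps : ∀ i ∈ (Finset.univ : Finset (Fin (profileParts n P))),
        (V i).card ∈ Finset.Icc 1 n := by
      intro i _
      by_contra hni
      have h0 := hprof.1 _ hni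
      rw [← hcount, Finset.card_eq_zero] at h0
      have : i ∈ Finset.univ.filter fun j => (V j).card = (V i).card := by simp
      rw [h0] at this
      simp at this
    rw [← Finset.sum_fiberwise_of_maps_to hmaps]
    refine Eq.trans ?_ hc
    refine Finset.sum_congr rfl fun u _ => ?_
    rw [← hcount u, Finset.sum_congr rfl (g := fun _ => u) (fun i hi => (Finset.mem_filter.1 hi).2),
      Finset.sum_const, smul_eq_mul, mul_comm]
  · rw [Finset.disjoint_left]
    intro e
    induction e with
    | _ v w =>
      rw [mem_es, mem_FV, SimpleGraph.mem_edgeSet]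
      rintro hadj ⟨i, hv, hw, _⟩
      exact hind i v hv w hw hadj

lemma fact_bound (n : ℕ) (P : ℕ → ℕ) (hk : 0 < profileParts n P) (T : ℕ) (hT : 0 < T)
    (hsupp : ∀ u, T < u → P u = 0) :
    (∏ u ∈ Finset.Icc 1 n, ((P u).factorial : ℝ))⁻¹ ≤
      (Real.exp 1 * T / profileParts n P) ^ profileParts n P := by
  set k := profileParts n P with hkdef
  have hk' : (0:ℝ) < k := by exact_mod_cast hk
  have hT' : (0:ℝ) < T := by exact_mod_cast hT
  set c : ℝ := k / T with hcdef
  have hc : 0 < c := by positivity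
  set S := (Finset.Icc 1 n).filter fun u => u ≤ T
  have hprod : ∏ u ∈ Finset.Icc 1 n, ((P u).factorial : ℝ) = ∏ u ∈ S, ((P u).factorial : ℝ) := by
    symm
    apply Finset.prod_subset (Finset.filter_subset _ _)
    intro u hu hu'
    have : T < u := by
      by_contra h
      exact hu' (Finset.mem_filter.2 ⟨hu, not_lt.1 h⟩)
    simp [hsupp u this]
  have hsum : ∑ u ∈ S, P u = k := by
    rw [hkdef, profileParts]
    apply Finset.sum_subset (Finset.filter_subset _ _)
    intro u hu hu'
    have : T < u := by
      by_contra h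
      exact hu' (Finset.mem_filter.2 ⟨hu, not_lt.1 h⟩)
    exact hsupp u this
  have hS : S.card ≤ T := by
    have : S ⊆ Finset.Icc 1 T := by
      intro u hu
      have := Finset.mem_filter.1 hu
      have h1 := Finset.mem_Icc.1 this.1
      exact Finset.mem_Icc.2 ⟨h1.1, this.2⟩
    simpa using Finset.card_le_card this
  rw [hprod, ← Finset.prod_inv_distrib]
  calc ∏ u ∈ S, ((P u).factorial : ℝ)⁻¹ ≤ ∏ u ∈ S, (Real.exp c * (c⁻¹) ^ (P u)) := by
        apply Finset.prod_le_prod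
        · intros; positivity
        · intro u _
          have h := Real.pow_div_factorial_le_exp c hc.le (P u)
          rw [inv_pow, ← div_eq_mul_inv, le_div_iff₀ (by positivity)]
          rwa [mul_comm, ← div_eq_mul_inv]
    _ = Real.exp c ^ S.card * (c⁻¹) ^ k := by
        rw [Finset.prod_mul_distrib, Finset.prod_const, Finset.prod_pow_eq_pow_sum, hsum]
    _ ≤ Real.exp c ^ T * (c⁻¹) ^ k := by
        gcongr
        exact Real.one_le_exp hc.le
    _ = (Real.exp 1 * T / k) ^ k := by
        rw [← Real.exp_nat_mul, hcdef, mul_div_cancel₀ _ hT'.ne', inv_div, mul_div_assoc, mul_pow,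
          ← Real.exp_nat_mul, mul_one]

lemma expect_bound {n : ℕ} (w : SimpleGraph (Fin n) → ℝ) (q K : ℝ) (hw : ∀ G, 0 ≤ w G)
    (hq : 0 < q) (hq1 : q ≤ 1) (hK : 0 ≤ K)
    (hF : ∀ F ⊆ allE n, ∑ G, w G * (if Disjoint (es G) F then (1:ℝ) else 0) ≤ K * q ^ F.card)
    (P : ℕ → ℕ) (hprof : IsProfile n (profileParts n P) P) (hc : IsCompleteProfile n P)
    (hk : 0 < profileParts n P) (T : ℕ) (hT : 0 < T) (hsupp : ∀ u, T < u → P u = 0) :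
    ∑ G, w G * Xbar G P ≤ K * (profileParts n P : ℝ) ^ n *
      q ^ (((n:ℝ)^2 / profileParts n P - n) / 2) *
      (Real.exp 1 * T / profileParts n P) ^ profileParts n P := by
  have h1 : ∑ G, w G * (Xprofile G P : ℝ) ≤ K * (profileParts n P : ℝ) ^ n *
      q ^ (((n:ℝ)^2 / profileParts n P - n) / 2) := by
    calc ∑ G, w G * (Xprofile G P : ℝ)
        ≤ ∑ G, w G * ∑ V ∈ tuples n (profileParts n P),
          (if Disjoint (es G) (FV V) then (1:ℝ) else 0) :=
          Finset.sum_le_sum fun G _ => mul_le_mul_of_nonneg_left (Xprofile_le G P hprof hc) (hw G)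
      _ = ∑ V ∈ tuples n (profileParts n P), ∑ G, w G *
          (if Disjoint (es G) (FV V) then (1:ℝ) else 0) := by
          simp only [Finset.mul_sum]
          exact Finset.sum_comm
      _ ≤ ∑ V ∈ tuples n (profileParts n P),
          K * q ^ (((n:ℝ)^2 / profileParts n P - n) / 2) := by
          refine Finset.sum_le_sum fun V hV => (hF _ (FV_sub V)).trans ?_
          have hV := (Finset.mem_filter.1 hV).2
          rw [← Real.rpow_natCast]
          exact mul_le_mul_of_nonneg_left
            (Real.rpow_le_rpow_of_exponent_ge hq hq1 (FV_card_ge hk V hV.1 hV.2)) hK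
      _ ≤ (profileParts n P : ℝ) ^ n * (K * q ^ (((n:ℝ)^2 / profileParts n P - n) / 2)) := by
          rw [Finset.sum_const, nsmul_eq_mul]
          apply mul_le_mul_of_nonneg_right _ (by positivity)
          exact_mod_cast card_tuples n _
      _ = _ := by ring
  have h2 := fact_bound n P hk T hT hsupp
  calc ∑ G, w G * Xbar G P = (∑ G, w G * (Xprofile G P : ℝ)) *
        (∏ u ∈ Finset.Icc 1 n, ((P u).factorial : ℝ))⁻¹ := by
        rw [Finset.sum_mul]
        exact Finset.sum_congr rfl fun G _ => by rw [Xbar]; ring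
    _ ≤ _ := mul_le_mul h1 h2 (by positivity) (by positivity)

lemma hF_m {n : ℕ} (hn : 2 ≤ n) (p : ℝ) (hp : p ∈ Set.Ioo (0:ℝ) 1) (F : Finset (Sym2 (Fin n)))
    (hF : F ⊆ allE n) :
    ∑ G : SimpleGraph (Fin n), ((if edgeCount G = mFloor p n then (1:ℝ) else 0) /
      ((n.choose 2).choose (mFloor p n) : ℕ)) * (if Disjoint (es G) F then (1:ℝ) else 0)
      ≤ Real.exp (1 / (1 - p)) * (1 - p) ^ F.card := by
  obtain ⟨hp0, hp1⟩ := hp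
  set N := n.choose 2 with hN
  set m := mFloor p n with hm
  have hN0 : 0 < N := Nat.choose_pos hn
  have hN' : (0:ℝ) < N := by exact_mod_cast hN0
  have hmle : (m:ℝ) ≤ p * N := Nat.floor_le (by positivity)
  have hmge : p * N < m + 1 := Nat.lt_floor_add_one _
  have hmN : m ≤ N := by
    have : (m:ℝ) ≤ N := by nlinarith
    exact_mod_cast this
  have hfN : F.card ≤ N := by rw [hN, ← card_allE]; exact Finset.card_le_card hF
  have hq : 0 < 1 - p := by linarith
  have hsum := count_m m F hF
  have heq : ∑ G : SimpleGraph (Fin n), ((if edgeCount G = m then (1:ℝ) else 0) /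
      (N.choose m : ℕ)) * (if Disjoint (es G) F then (1:ℝ) else 0) =
      ((N - F.card).choose m : ℕ) / (N.choose m : ℕ) := by
    rw [← hsum, Finset.sum_div]
    exact Finset.sum_congr rfl fun G _ => by ring
  rw [heq]
  have hch : (0:ℝ) < (N.choose m : ℕ) := by exact_mod_cast Nat.choose_pos hmN
  rw [div_le_iff₀ hch]
  refine (choose_ratio N m F.card hN0 hmN hfN).trans ?_
  rw [mul_comm]
  apply mul_le_mul_of_nonneg_right _ hch.le
  have hfN' : (F.card : ℝ) ≤ N := by exact_mod_cast hfN
  have hm' : (m:ℝ) ≤ N := by exact_mod_cast hmN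
  calc (((N:ℝ) - m) / N) ^ F.card ≤ (Real.exp (1 / ((1-p) * N)) * (1 - p)) ^ F.card := by
        apply pow_le_pow_left₀ (div_nonneg (by linarith) hN'.le)
        have h1 := Real.add_one_le_exp (1 / ((1-p) * N))
        calc ((N:ℝ) - m) / N ≤ (1 / ((1-p) * N) + 1) * (1 - p) := by
              rw [div_le_iff₀ hN']
              have : (1 / ((1-p) * N) + 1) * (1 - p) * N = 1 + (1-p) * N := by field_simp
              rw [this]; linarith
          _ ≤ _ := mul_le_mul_of_nonneg_right h1 hq.le
    _ = Real.exp (F.card * (1 / ((1-p) * N))) * (1 - p) ^ F.card := by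
        rw [mul_pow, ← Real.exp_nat_mul]
    _ ≤ _ := by
        apply mul_le_mul_of_nonneg_right _ (by positivity)
        rw [Real.exp_le_exp, mul_one_div, div_le_div_iff₀ (by positivity) hq]
        nlinarith

/-- Common bound for both models. -/
lemma both_bound {n : ℕ} (hn : 2 ≤ n) (p : ℝ) (hp : p ∈ Set.Ioo (0:ℝ) 1)
    (P : ℕ → ℕ) (hprof : IsProfile n (profileParts n P) P) (hc : IsCompleteProfile n P)
    (hk : 0 < profileParts n P) (T : ℕ) (hT : 0 < T) (hsupp : ∀ u, T < u → P u = 0) (B : ℝ)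
    (hB : Real.exp (1 / (1 - p)) * (profileParts n P : ℝ) ^ n *
      (1 - p) ^ (((n:ℝ)^2 / profileParts n P - n) / 2) *
      (Real.exp 1 * T / profileParts n P) ^ profileParts n P < B) :
    Em n (mFloor p n) (fun G => Xbar G P) < B ∧ Ep n p (fun G => Xbar G P) < B := by
  have hq : 0 < 1 - p := by linarith [hp.2]
  have hq1 : 1 - p ≤ 1 := by linarith [hp.1]
  constructor
  · rw [Em_eq]
    refine lt_of_le_of_lt (expect_bound _ (1 - p) _ (fun G => ?_) hq hq1 (Real.exp_pos _).le
      (hF_m hn p hp) P hprof hc hk T hT hsupp) hB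
    split_ifs <;> positivity
  · rw [Ep_eq]
    refine lt_of_le_of_lt (expect_bound _ (1 - p) _ (fun G => ?_) hq hq1 (Real.exp_pos _).le
      (fun F hF => ?_) P hprof hc hk T hT hsupp) hB
    · have := hp.1.le
      positivity
    · rw [prob_p p F hF]
      have : 1 ≤ Real.exp (1 / (1-p)) := Real.one_le_exp (by positivity)
      exact le_mul_of_one_le_left (by positivity) this

open Real in
lemma analytic (β D : ℝ) (hβ : 0 < β) :
    ∃ a1 : ℝ → ℝ, (∀ y, a1 y = 2 * y - 2 / β * log y + D) ∧
    Tendsto (fun y => a1 y / y) atTop (nhds 2) ∧ Tendsto a1 atTop atTop ∧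
    Tendsto (fun y => log (a1 y) - log y) atTop (nhds (log 2)) ∧
    Tendsto (fun y => (β * y) / a1 y) atTop (nhds (β / 2)) ∧
    Tendsto (fun y => (1 + 2 * (log 40 + log y)) / a1 y) atTop (nhds 0) ∧
    Tendsto (fun y => (β * y) / a1 y ^ 2) atTop (nhds 0) := by
  refine ⟨fun y => 2 * y - 2 / β * log y + D, fun y => rfl, ?_⟩
  have hlog : Tendsto (fun y : ℝ => log y / y) atTop (nhds 0) :=
    Real.isLittleO_log_id_atTop.tendsto_div_nhds_zero
  have hinv : Tendsto (fun y : ℝ => y⁻¹) atTop (nhds 0) := tendsto_inv_atTop_zero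
  have h1 : Tendsto (fun y => (2 * y - 2 / β * log y + D) / y) atTop (nhds 2) := by
    have : Tendsto (fun y : ℝ => 2 - 2 / β * (log y / y) + D * y⁻¹) atTop (nhds (2 - 2/β * 0 + D * 0)) :=
      (tendsto_const_nhds.sub (hlog.const_mul _)).add (hinv.const_mul _)
    simp only [mul_zero, sub_zero, add_zero] at this
    refine this.congr' ?_
    filter_upwards [eventually_gt_atTop 0] with y hy
    field_simp
  have h2 : Tendsto (fun y => 2 * y - 2 / β * log y + D) atTop atTop := by
    have := h1.pos_mul_atTop (by norm_num) tendsto_id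
    refine this.congr' ?_
    filter_upwards [eventually_gt_atTop 0] with y hy
    simp only [id]
    field_simp
  have hya : Tendsto (fun y => y / (2 * y - 2 / β * log y + D)) atTop (nhds (1/2)) := by
    have := h1.inv₀ (by norm_num)
    simpa using this
  refine ⟨h1, h2, ?_, ?_, ?_, ?_⟩
  · refine ((Real.continuousAt_log (by norm_num : (2:ℝ) ≠ 0)).tendsto.comp h1).congr' ?_
    filter_upwards [eventually_gt_atTop 0, h2.eventually_gt_atTop 0] with y hy hy2
    simp only [Function.comp]
    rw [Real.log_div hy2.ne' hy.ne']
  · have := hya.const_mul β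
    refine (this.congr fun y => ?_).trans (by rw [mul_one_div])
    ring
  · have h3 : Tendsto (fun y : ℝ => (1 + 2 * log 40) * y⁻¹ + 2 * (log y / y)) atTop
        (nhds ((1 + 2 * log 40) * 0 + 2 * 0)) := (hinv.const_mul _).add (hlog.const_mul _)
    have h4 := h3.mul hya
    simp only [mul_zero, add_zero, zero_mul] at h4
    refine h4.congr' ?_
    filter_upwards [eventually_gt_atTop 0, h2.eventually_gt_atTop 0] with y hy hy2
    field_simp
    ring
  · have h4 := ((hya.mul hya).mul hinv).const_mul β
    simp only [mul_zero] at h4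
    refine h4.congr' ?_
    filter_upwards [eventually_gt_atTop 0, h2.eventually_gt_atTop 0] with y hy hy2
    field_simp

open Real in
lemma final_ineq (n k T : ℕ) (β C ε q y a1 : ℝ) (hn : 0 < n) (hk : 0 < k) (hT : 0 < T)
    (hβ : 0 < β) (hq : 0 < q) (hqβ : log q = -β) (hy : y = log n / β)
    (ha1 : 0 < a1) (ha1def : a1 = 2 * y - 2 / β * log y + (2 * (1 - log 2) / β - 2 / β + C))
    (ha : a1 < (n:ℝ) / k) (haT : (n:ℝ) / k ≤ T) (hTy : (T:ℝ) ≤ 40 * y) (hy0 : 0 < y)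
    (h1 : log 2 - (log a1 - log y) < ε / 4)
    (h2 : β / 2 - (β * y) / a1 < ε / 4)
    (h3 : (1 + 2 * (log 40 + log y)) / a1 < ε / 4)
    (h4 : (β * y) / a1 ^ 2 ≤ β / 2) (h5 : 1 / q / n < ε / 4) :
    exp (1 / q) * (k : ℝ) ^ n * q ^ (((n:ℝ)^2 / k - n) / 2) * (exp 1 * T / k) ^ k <
      exp ((-(C * β / 2) + ε) * n) := by
  have hn' : (0:ℝ) < n := by exact_mod_cast hn
  have hk' : (0:ℝ) < k := by exact_mod_cast hk
  have hT' : (0:ℝ) < T := by exact_mod_cast hT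
  have hT1 : (1:ℝ) ≤ T := by exact_mod_cast hT
  set a : ℝ := n / k with hadef
  have ha0 : 0 < a := by positivity
  have hka : (k:ℝ) = n / a := by rw [hadef]; field_simp
  have hL : log n = β * y := by rw [hy]; field_simp
  have hlk : log k = β * y - log a := by rw [hka, log_div hn'.ne' ha0.ne', hL]
  have e : exp (1 / q) * (k : ℝ) ^ n * q ^ (((n:ℝ)^2 / k - n) / 2) * (exp 1 * T / k) ^ k =
      exp (1 / q + n * log k + log q * (((n:ℝ)^2 / k - n) / 2) + k * (1 + log T - log k)) := by
    rw [exp_add, exp_add, exp_add, rpow_def_of_pos hq]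
    congr 1
    · congr 2
      rw [exp_nat_mul, exp_log hk']
    · rw [exp_nat_mul, exp_sub, exp_add, exp_log hT', exp_log hk']
  rw [e, exp_lt_exp, hqβ, hlk]
  have e2 : 1 / q + n * (β * y - log a) + -β * (((n:ℝ)^2 / k - n) / 2) +
      k * (1 + log T - (β * y - log a)) =
      (1 / q / n + β * y - log a - β / 2 * (a - 1) + (1 + log T + log a) / a - β * y / a) * n := by
    rw [hka]; field_simp; ring
  rw [e2]
  apply mul_lt_mul_of_pos_right _ hn'
  have hlT : log T ≤ log 40 + log y := by
    rw [← log_mul (by norm_num) hy0.ne']; exact log_le_log hT' hTy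
  have hla : log a ≤ log T := log_le_log ha0 haT
  have hlT0 : 0 ≤ log T := log_nonneg hT1
  have i1 : (1 + log T + log a) / a ≤ (1 + 2 * (log 40 + log y)) / a1 := by
    apply div_le_div₀ <;> linarith
  have i2 : log a1 ≤ log a := log_le_log ha1 ha.le
  have i3 : β * y / a1 - β * y / a ≤ β / 2 * (a - a1) := by
    have : β * y / a1 - β * y / a = β * y * (a - a1) / (a1 * a) := by field_simp
    rw [this]
    calc β * y * (a - a1) / (a1 * a) ≤ β * y * (a - a1) / (a1 * a1) := by
          apply div_le_div_of_nonneg_left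
          · exact mul_nonneg (by positivity) (by linarith)
          · positivity
          · exact mul_le_mul_of_nonneg_left ha.le ha1.le
      _ = β * y / a1 ^ 2 * (a - a1) := by ring
      _ ≤ _ := mul_le_mul_of_nonneg_right h4 (by linarith)
  have i4 : β / 2 * (a1 - 1) = β * y - log y - log 2 + C * β / 2 - β / 2 := by
    rw [ha1def]; field_simp; ring
  have i5 : β / 2 * (a - 1) = β / 2 * (a - a1) + β / 2 * (a1 - 1) := by ring
  linarith

/-- Lemma 3.4: if the average colour class size `n/k` exceeds
`α₀ − 1 − 2/ln b + C`, then the expected number of unordered colourings with that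
profile is at most `exp(−(C ln b/2) n + o(n))`. -/
theorem expectation_upper_bound (p C : ℝ) (hp : p ∈ Set.Ioo (0:ℝ) 1) (hC : 0 < C)
    (P : ℕ → ℕ → ℕ)
    (hprof : ∀ n, IsProfile n (profileParts n (P n)) (P n) ∧ IsCompleteProfile n (P n))
    (hsupp : ∀ n, ∀ u : ℕ, ((u : ℝ) < 0.1 * (alphaNat (1/(1-p)) n : ℝ) ∨
        10 * (alphaNat (1/(1-p)) n : ℝ) < (u : ℝ)) → P n u = 0)
    (havg : ∀ n : ℕ, (n : ℝ) / (profileParts n (P n) : ℝ) >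
        alpha0 (1/(1-p)) n - 1 - 2 / Real.log (1/(1-p)) + C) :
    ∀ ε : ℝ, 0 < ε → ∀ᶠ n : ℕ in atTop,
      Em n (mFloor p n) (fun G => Xbar G (P n)) <
        Real.exp ((-(C * Real.log (1/(1-p)) / 2) + ε) * n) ∧
      Ep n p (fun G => Xbar G (P n)) <
        Real.exp ((-(C * Real.log (1/(1-p)) / 2) + ε) * n) := by
  intro ε hε
  obtain ⟨hp0, hp1⟩ := hp
  set b : ℝ := 1 / (1 - p) with hb
  set β : ℝ := Real.log b with hβdef
  have hq : 0 < 1 - p := by linarith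
  have hb1 : 1 < b := by rw [hb, lt_div_iff₀ hq]; linarith
  have hβ : 0 < β := Real.log_pos hb1
  have hqβ : Real.log (1 - p) = -β := by rw [hβdef, hb, one_div, Real.log_inv, neg_neg]
  set D : ℝ := 2 * (1 - Real.log 2) / β - 2 / β + C with hD
  obtain ⟨a1, ha1, t1, t2, t3, t4, t5, t6⟩ := analytic β D hβ
  have hy : Tendsto (fun n : ℕ => Real.log n / β) atTop atTop :=
    (Real.tendsto_log_atTop.comp tendsto_natCast_atTop_atTop).atTop_div_const hβ
  have hα : ∀ n : ℕ, alpha0 b n = a1 (Real.log n / β) + 1 + 2 / β - C := by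
    intro n
    rw [ha1, alpha0, hD]
    simp only [Real.logb, ← hβdef]
    rw [Real.log_div (Real.exp_pos 1).ne' (by norm_num), Real.log_exp]
    ring
  have hev : ∀ᶠ y : ℝ in atTop, 0 < y ∧ 0 < a1 y ∧ 1 ≤ a1 y + 1 + 2 / β - C ∧
      a1 y + 1 + 2 / β - C ≤ 4 * y ∧ Real.log 2 - (Real.log (a1 y) - Real.log y) < ε / 4 ∧
      β / 2 - (β * y) / a1 y < ε / 4 ∧
      (1 + 2 * (Real.log 40 + Real.log y)) / a1 y < ε / 4 ∧
      (β * y) / a1 y ^ 2 ≤ β / 2 := by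
    filter_upwards [eventually_gt_atTop 0, t2.eventually_gt_atTop 0,
      t2.eventually_ge_atTop (C - 2 / β), t1.eventually_lt_const (show (2:ℝ) < 3 by norm_num),
      eventually_ge_atTop (1 + 2 / β - C),
      t3.eventually_const_lt (show Real.log 2 - ε / 4 < Real.log 2 by linarith),
      t4.eventually_const_lt (show β / 2 - ε / 4 < β / 2 by linarith),
      t5.eventually_lt_const (show 0 < ε / 4 by linarith),
      t6.eventually_lt_const (show 0 < β / 2 by linarith)] with y h1 h2 h3 h4 h5 h6 h7 h8 h9
    rw [div_lt_iff₀ h1] at h4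
    exact ⟨h1, h2, by linarith, by linarith, by linarith, by linarith, h8, h9.le⟩
  have h5 : ∀ᶠ n : ℕ in atTop, 1 / (1 - p) / (n:ℝ) < ε / 4 :=
    (tendsto_const_div_atTop_nhds_zero_nat _).eventually_lt_const (by linarith)
  filter_upwards [hy.eventually hev, h5, eventually_ge_atTop 2] with n hn hn5 hn2
  obtain ⟨g1, g2, g3, g4, g5, g6, g7, g8⟩ := hn
  have hn0 : 0 < n := by omega
  have hn0' : (0:ℝ) < n := by exact_mod_cast hn0
  have hav : a1 (Real.log n / β) < (n:ℝ) / (profileParts n (P n) : ℝ) := by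
    have := havg n
    rw [hα n] at this
    linarith
  have hk : 0 < profileParts n (P n) := by
    rcases Nat.eq_zero_or_pos (profileParts n (P n)) with h | h
    · rw [h] at hav; simp at hav; linarith
    · exact h
  have hk' : (0:ℝ) < profileParts n (P n) := by exact_mod_cast hk
  rw [← hα n] at g3 g4
  have hα1 : 1 ≤ alphaNat b n := Nat.le_floor (by exact_mod_cast g3)
  have hαle : (alphaNat b n : ℝ) ≤ alpha0 b n := Nat.floor_le (by linarith)
  have hsT : ∀ u, 10 * alphaNat b n < u → P n u = 0 := by
    intro u hu
    apply hsupp n u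
    right
    exact_mod_cast hu
  refine both_bound hn2 p ⟨hp0, hp1⟩ (P n) (hprof n).1 (hprof n).2 hk (10 * alphaNat b n)
    (by omega) hsT _ ?_
  refine final_ineq n (profileParts n (P n)) (10 * alphaNat b n) β C ε (1 - p) (Real.log n / β)
    (a1 (Real.log n / β)) hn0 hk (by omega) hβ hq hqβ rfl g2 (ha1 _) hav ?_ ?_ g1 g5 g6 g7 g8 hn5
  · rw [div_le_iff₀ hk']
    have h : n ≤ (10 * alphaNat b n) * profileParts n (P n) := by
      conv_lhs => rw [← (hprof n).2]
      rw [profileParts, Finset.mul_sum]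
      refine Finset.sum_le_sum fun u _ => ?_
      by_cases hu : 10 * alphaNat b n < u
      · simp [hsT u hu]
      · exact Nat.mul_le_mul_right _ (not_lt.1 hu)
    exact_mod_cast h
  · push_cast
    linarith
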